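/- For every increasing sequence (N_n) of positive numbers there exists a homeomorphism η : [0,∞) → [0,∞) such that η is C^∞ on (0,∞), η′(t) > 0 for t > 0, η(t) = t for t ≥ 1, and N_n · sup_{0 < t ≤ 2^{−n}} sup_{0 ≤ ℓ ≤ n} |η^{(ℓ)}(t)| → 0 as n → ∞. -/

import Mathlib

open Set

open Filter Topology

/-- A smooth function which is constant to the left of `a` and to the right of `b` has bounded
derivatives of every order. -/
theorem exists_bound_iteratedDeriv_of_eq_const {f : ℝ → ℝ} (hf : ContDiff ℝ (⊤ : ℕ∞) f)
    {a b c d : ℝ} (hc : ∀ x < a, f x = c) (hd : ∀ x > b, f x = d) (k : ℕ) :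
    ∃ C, ∀ x, |iteratedDeriv k f x| ≤ C := by
  have hcont : Continuous (iteratedDeriv k f) := hf.continuous_iteratedDeriv k (mod_cast le_top)
  obtain ⟨C, hC⟩ := (isCompact_Icc (a := a) (b := b)).exists_bound_of_continuousOn
    hcont.continuousOn
  have key : ∀ e x, f =ᶠ[𝓝 x] (fun _ ↦ e) → |iteratedDeriv k f x| ≤ |e| := by
    intro e x h
    rw [h.iteratedDeriv_eq, iteratedDeriv_const]
    split_ifs <;> simp
  refine ⟨|C| + |c| + |d|, fun x ↦ ?_⟩
  have hC0 := abs_nonneg C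
  have hc0 := abs_nonneg c
  have hd0 := abs_nonneg d
  rcases lt_or_ge x a with hxa | hxa
  · linarith [key c x (by filter_upwards [Iio_mem_nhds hxa] with y hy using hc y hy)]
  rcases lt_or_ge b x with hxb | hxb
  · linarith [key d x (by filter_upwards [Ioi_mem_nhds hxb] with y hy using hd y hy)]
  have := hC x ⟨hxa, hxb⟩
  rw [Real.norm_eq_abs] at this
  linarith [le_abs_self C]

/-- Smooth functions with bounded derivatives can be summed, after multiplication by sufficiently
small positive coefficients, to a smooth function, with prescribed decay of the terms. -/
theorem exists_coeff_contDiff_tsum {g : ℕ → ℝ → ℝ} (hg : ∀ n, ContDiff ℝ (⊤ : ℕ∞) (g n))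
    (hb : ∀ n k, ∃ C, ∀ t, |iteratedDeriv k (g n) t| ≤ C) {M : ℕ → ℝ} (hM : ∀ n, 1 ≤ M n) :
    ∃ a : ℕ → ℝ, (∀ n, 0 < a n) ∧ ContDiff ℝ (⊤ : ℕ∞) (fun t ↦ ∑' n, a n * g n t) ∧
      (∀ k t, Summable fun n ↦ a n * iteratedDeriv k (g n) t) ∧
      (∀ k t, iteratedDeriv k (fun t ↦ ∑' n, a n * g n t) t =
        ∑' n, a n * iteratedDeriv k (g n) t) ∧
      ∀ n, ∀ k ≤ n, ∀ t, M n * |a n * iteratedDeriv k (g n) t| ≤ (1 / 2) ^ (n + 2) := by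
  choose C hC using hb
  have hC0 : ∀ n k, 0 ≤ C n k := fun n k ↦ (abs_nonneg _).trans (hC n k 0)
  set B : ℕ → ℝ := fun n ↦ 1 + ∑ k ∈ Finset.range (n + 1), C n k with hB
  have hCB : ∀ n, ∀ k ≤ n, C n k ≤ B n := by
    intro n k hk
    have := Finset.single_le_sum (f := C n) (fun i _ ↦ hC0 n i)
      (Finset.mem_range.2 (Nat.lt_succ_of_le hk))
    simp only [hB]
    linarith
  have hB0 : ∀ n, 0 < B n := by
    intro n
    have := Finset.sum_nonneg (s := Finset.range (n + 1)) (fun i _ ↦ hC0 n i)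
    simp only [hB]
    linarith
  have hM0 : ∀ n, 0 < M n := fun n ↦ one_pos.trans_le (hM n)
  set a : ℕ → ℝ := fun n ↦ (1 / 2) ^ (n + 2) / (M n * B n) with ha
  have ha0 : ∀ n, 0 < a n := fun n ↦ div_pos (by positivity) (mul_pos (hM0 n) (hB0 n))
  have haMB : ∀ n, M n * (a n * B n) = (1 / 2) ^ (n + 2) := by
    intro n
    have := (hM0 n).ne'
    have := (hB0 n).ne'
    simp only [ha]
    field_simp
  have haC : ∀ n, ∀ k ≤ n, M n * (a n * C n k) ≤ (1 / 2) ^ (n + 2) := by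
    intro n k hk
    rw [← haMB n]
    exact mul_le_mul_of_nonneg_left (mul_le_mul_of_nonneg_left (hCB n k hk) (ha0 n).le) (hM0 n).le
  have hgeom : Summable fun n : ℕ ↦ (1 / 2 : ℝ) ^ (n + 2) :=
    (summable_nat_add_iff 2).2 summable_geometric_two
  have hsum : ∀ k, Summable fun n ↦ a n * C n k := by
    intro k
    refine hgeom.of_norm_bounded_eventually_nat ?_
    filter_upwards [eventually_ge_atTop k] with n hn
    have h0 : 0 ≤ a n * C n k := mul_nonneg (ha0 n).le (hC0 n k)
    rw [Real.norm_of_nonneg h0]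
    exact (le_mul_of_one_le_left h0 (hM n)).trans (haC n k hn)
  have hterm : ∀ n k t, |a n * iteratedDeriv k (g n) t| ≤ a n * C n k := by
    intro n k t
    rw [abs_mul, abs_of_pos (ha0 n)]
    exact mul_le_mul_of_nonneg_left (hC n k t) (ha0 n).le
  have hsm : ∀ n, ContDiff ℝ (⊤ : ℕ∞) fun t ↦ a n * g n t := fun n ↦ contDiff_const.mul (hg n)
  have hbd : ∀ (k n : ℕ) (t : ℝ), (k : ℕ∞) ≤ ⊤ →
      ‖iteratedFDeriv ℝ k (fun t ↦ a n * g n t) t‖ ≤ a n * C n k := by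
    intro k n t _
    rw [norm_iteratedFDeriv_eq_norm_iteratedDeriv, iteratedDeriv_const_mul_field]
    exact hterm n k t
  have hsumm : ∀ k t, Summable fun n ↦ a n * iteratedDeriv k (g n) t := fun k t ↦
    (hsum k).of_norm_bounded fun n ↦ hterm n k t
  refine ⟨a, ha0, contDiff_tsum hsm (fun k _ ↦ hsum k) hbd, hsumm, fun k t ↦ ?_,
    fun n k hk t ↦ (mul_le_mul_of_nonneg_left (hterm n k t) (hM0 n).le).trans (haC n k hk)⟩
  have hF : Summable fun n ↦ iteratedFDeriv ℝ k (fun t ↦ a n * g n t) t :=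
    (hsum k).of_norm_bounded fun n ↦ hbd k n t le_top
  rw [iteratedDeriv, iteratedFDeriv_tsum_apply hsm (fun k _ ↦ hsum k) hbd le_top,
    ContinuousMultilinearMap.tsum_eval hF]
  refine tsum_congr fun n ↦ ?_
  rw [← iteratedDeriv_const_mul_field, iteratedDeriv]

theorem expNegInvGlue.deriv_pos {x : ℝ} (hx : 0 < x) : 0 < deriv expNegInvGlue x := by
  have h := expNegInvGlue.hasDerivAt_polynomial_eval_inv_mul 1 x
  simp only [Polynomial.eval_one, one_mul, Polynomial.derivative_one, sub_zero, mul_one,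
    Polynomial.eval_pow, Polynomial.eval_X] at h
  rw [h.deriv]
  exact mul_pos (by positivity) (expNegInvGlue.pos_of_pos hx)

theorem Real.smoothTransition.deriv_pos {x : ℝ} (h0 : 0 < x) (h1 : x < 1) :
    0 < deriv Real.smoothTransition x := by
  have hd : Differentiable ℝ expNegInvGlue :=
    (expNegInvGlue.contDiff (n := 1)).differentiable (by norm_num)
  have hu := (hd x).hasDerivAt
  have hv := (hd (1 - x)).hasDerivAt.comp x ((hasDerivAt_id x).const_sub 1)
  have h := hu.div (hu.add hv) (Real.smoothTransition.pos_denom x).ne'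
  have heq : deriv Real.smoothTransition x = _ := h.deriv
  rw [heq]
  have p1 := expNegInvGlue.deriv_pos h0
  have p2 := expNegInvGlue.deriv_pos (sub_pos.2 h1)
  have p3 := expNegInvGlue.pos_of_pos h0
  have p4 := expNegInvGlue.pos_of_pos (sub_pos.2 h1)
  refine div_pos ?_ (pow_pos (Real.smoothTransition.pos_denom x) 2)
  simp only [Pi.add_apply, Function.comp_apply]
  nlinarith [mul_pos p1 p4, mul_pos p3 p2]

/-- For a monotone weight `M`, there is a smooth function vanishing on `(-∞, 0]`, increasing, with
positive derivative on `(0, 1]`, whose derivatives of order at most `n` are bounded by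
`1 / (2 M n)` on `(-∞, 2⁻ⁿ]`. -/
theorem exists_contDiff_flat {M : ℕ → ℝ} (hM : ∀ n, 1 ≤ M n) (hmono : Monotone M) :
    ∃ F : ℝ → ℝ, ContDiff ℝ (⊤ : ℕ∞) F ∧ F 0 = 0 ∧ (∀ t, 0 ≤ deriv F t) ∧
      (∀ t, 0 < t → t ≤ 1 → 0 < deriv F t) ∧ (∀ t, F t ≤ 1 / 2) ∧
      ∀ n, ∀ t ≤ (1 / 2 : ℝ) ^ n, ∀ k ≤ n, M n * |iteratedDeriv k F t| ≤ 1 / 2 := by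
  set S := Real.smoothTransition
  set g : ℕ → ℝ → ℝ := fun n t ↦ S ((2 ^ n * t - 2) / 8)
  have hg : ∀ n, ContDiff ℝ (⊤ : ℕ∞) (g n) := fun n ↦
    Real.smoothTransition.contDiff.comp (by fun_prop)
  have hp : ∀ n : ℕ, (0 : ℝ) < 2 ^ n := fun n ↦ by positivity
  have hzero : ∀ n t, 2 ^ n * t ≤ 2 → g n t = 0 := fun n t ht ↦
    Real.smoothTransition.zero_of_nonpos (by linarith)
  have hone : ∀ n t, 10 ≤ 2 ^ n * t → g n t = 1 := fun n t ht ↦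
    Real.smoothTransition.one_of_one_le (by linarith)
  have hb : ∀ n k, ∃ C, ∀ t, |iteratedDeriv k (g n) t| ≤ C := by
    intro n k
    refine exists_bound_iteratedDeriv_of_eq_const (hg n) (a := 2 / 2 ^ n) (b := 10 / 2 ^ n)
      (fun t ht ↦ hzero n t ?_) (fun t ht ↦ hone n t ?_) k
    · rw [lt_div_iff₀ (hp n)] at ht
      linarith
    · rw [gt_iff_lt, div_lt_iff₀ (hp n)] at ht
      linarith
  obtain ⟨a, ha0, hF, hsumm, hderiv, hdecay⟩ := exists_coeff_contDiff_tsum hg hb hM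
  have hgeom : HasSum (fun n : ℕ ↦ (1 / 2 : ℝ) ^ (n + 2)) (1 / 2) := by
    have h := hasSum_geometric_two.mul_right ((1 / 2 : ℝ) ^ 2)
    simp only [← pow_add] at h
    norm_num at h ⊢
    exact h
  have hgd : ∀ n t, deriv (g n) t = deriv S ((2 ^ n * t - 2) / 8) * (2 ^ n / 8) := by
    intro n t
    have h1 : HasDerivAt (fun t : ℝ ↦ (2 ^ n * t - 2) / 8) (2 ^ n / 8) t := by
      simpa using (((hasDerivAt_id t).const_mul (2 ^ n : ℝ)).sub_const 2).div_const 8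
    have h2 : DifferentiableAt ℝ S ((2 ^ n * t - 2) / 8) :=
      (Real.smoothTransition.contDiff (n := 1)).differentiable (by norm_num) _
    exact (h2.hasDerivAt.comp t h1).deriv
  have hgd0 : ∀ n t, 0 ≤ a n * iteratedDeriv 1 (g n) t := by
    intro n t
    rw [iteratedDeriv_one, hgd]
    exact mul_nonneg (ha0 n).le
      (mul_nonneg Real.smoothTransition.monotone.deriv_nonneg (by positivity))
  refine ⟨fun t ↦ ∑' n, a n * g n t, hF, ?_, fun t ↦ ?_, fun t ht0 ht1 ↦ ?_, fun t ↦ ?_,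
    fun n t ht k hk ↦ ?_⟩
  · simp [hzero]
  · rw [← iteratedDeriv_one, hderiv]
    exact tsum_nonneg fun n ↦ hgd0 n t
  · rw [← iteratedDeriv_one, hderiv]
    obtain ⟨m, hm1, hm2⟩ := exists_nat_pow_near_of_lt_one ht0 ht1 (y := (1 / 2 : ℝ))
      (by norm_num) (by norm_num)
    refine (hsumm 1 t).tsum_pos (fun n ↦ hgd0 n t) (m + 3) ?_
    rw [one_div, inv_pow, inv_lt_iff_one_lt_mul₀ (hp _), pow_succ] at hm1
    rw [one_div, inv_pow, le_inv_comm₀ ht0 (hp _), ← one_div, le_div_iff₀ ht0] at hm2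
    rw [iteratedDeriv_one, hgd]
    refine mul_pos (ha0 _) (mul_pos (Real.smoothTransition.deriv_pos ?_ ?_) (by positivity))
    · rw [pow_add]
      nlinarith
    · rw [pow_add]
      nlinarith
  · refine (Real.le_norm_self _).trans (tsum_of_norm_bounded hgeom fun n ↦ ?_)
    have h := hdecay n 0 n.zero_le t
    rw [iteratedDeriv_zero] at h
    exact (le_mul_of_one_le_left (abs_nonneg _) (hM n)).trans h
  · have hMn : 0 < M n := one_pos.trans_le (hM n)
    rw [hderiv, ← abs_of_pos hMn, ← abs_mul, ← tsum_mul_left]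
    rw [← Real.norm_eq_abs]
    refine tsum_of_norm_bounded hgeom fun m ↦ ?_
    rw [Real.norm_eq_abs, abs_mul, abs_of_pos hMn]
    rcases le_total n m with hnm | hmn
    · exact (mul_le_mul_of_nonneg_right (hmono hnm) (abs_nonneg _)).trans
        (hdecay m k (hk.trans hnm) t)
    · have hmt : 2 ^ m * t < 2 := by
        have h1 : t ≤ (1 / 2 : ℝ) ^ m :=
          ht.trans (pow_le_pow_of_le_one (by norm_num) (by norm_num) hmn)
        rw [one_div, inv_pow, ← one_div, le_div_iff₀ (hp m)] at h1
        linarith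
      have hev : g m =ᶠ[𝓝 t] fun _ ↦ 0 := by
        have hcont : Continuous fun s : ℝ ↦ 2 ^ m * s := by fun_prop
        filter_upwards [hcont.continuousAt.eventually_lt continuousAt_const hmt] with s hs
        exact hzero m s hs.le
      rw [hev.iteratedDeriv_eq, iteratedDeriv_const]
      simp

/-- **Lemma (flat homeomorphism of `[0,∞)`).** For every increasing sequence `(N_n)` of
positive numbers there is a homeomorphism `η : [0,∞) → [0,∞)`, smooth on `(0,∞)` with
`η' > 0` there, equal to the identity for `t ≥ 1`, such that
`N_n · sup_{0 < t ≤ 2^{-n}} sup_{0 ≤ ℓ ≤ n} |η^{(ℓ)}(t)| → 0` as `n → ∞`. -/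
theorem stmt_13 (N : ℕ → ℝ) (hNpos : ∀ n, 0 < N n) (hNmono : StrictMono N) :
    ∃ η : ℝ → ℝ,
      ContinuousOn η (Set.Ici 0) ∧ StrictMonoOn η (Set.Ici 0) ∧ η 0 = 0 ∧
      η '' Set.Ici 0 = Set.Ici 0 ∧
      ContDiffOn ℝ (⊤ : ℕ∞) η (Set.Ioi 0) ∧ (∀ t : ℝ, 0 < t → 0 < deriv η t) ∧
      (∀ t : ℝ, 1 ≤ t → η t = t) ∧
      ∀ ε : ℝ, 0 < ε → ∃ n₀ : ℕ, ∀ n ≥ n₀, ∀ t ∈ Set.Ioc (0:ℝ) ((2:ℝ) ^ (-(n:ℤ))),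
        ∀ ℓ ≤ n, N n * |iteratedDeriv ℓ η t| < ε := by
  have hNm := hNmono.monotone
  obtain ⟨F, hF, hF0, hFd, hFd', hFle, hFdecay⟩ :=
    exists_contDiff_flat (M := fun n ↦ 2 ^ n * (1 + N n))
      (fun n ↦ one_le_mul_of_one_le_of_one_le (one_le_pow₀ (by norm_num))
        (by linarith [hNpos n]))
      (fun m n h ↦ mul_le_mul (pow_le_pow_right₀ (by norm_num) h)
        (by linarith [hNm h]) (by linarith [hNpos m]) (by positivity))
  set χ : ℝ → ℝ := fun t ↦ Real.smoothTransition (2 * t - 1)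
  have hχ : ContDiff ℝ (⊤ : ℕ∞) χ := Real.smoothTransition.contDiff.comp (by fun_prop)
  have hχm : Monotone χ := fun s t h ↦ Real.smoothTransition.monotone (by linarith)
  have hχ0 : ∀ t ≤ 1 / 2, χ t = 0 := fun t ht ↦
    Real.smoothTransition.zero_of_nonpos (by linarith)
  have hχ1 : ∀ t, 1 ≤ t → χ t = 1 := fun t ht ↦
    Real.smoothTransition.one_of_one_le (by linarith)
  set η : ℝ → ℝ := fun t ↦ (1 - χ t) * F t + χ t * t with hη_def
  have hη : ContDiff ℝ (⊤ : ℕ∞) η := ((contDiff_const.sub hχ).mul hF).add (hχ.mul contDiff_id)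
  have hη0 : η 0 = 0 := by simp [hη_def, hF0]
  have hη1 : ∀ t, 1 ≤ t → η t = t := fun t ht ↦ by simp [hη_def, hχ1 t ht]
  have hηF : ∀ t < 1 / 2, η =ᶠ[𝓝 t] F := by
    intro t ht
    filter_upwards [Iio_mem_nhds ht] with s hs
    simp [hη_def, hχ0 s (le_of_lt hs)]
  have hηd : ∀ t, deriv η t = (1 - χ t) * deriv F t + χ t + deriv χ t * (t - F t) := by
    intro t
    have h1 := (hχ.differentiable (by simp) t).hasDerivAt
    have h2 := (hF.differentiable (by simp) t).hasDerivAt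
    have h3 := ((h1.const_sub 1).mul h2).add (h1.mul (hasDerivAt_id t))
    have h4 : deriv η t = _ := h3.deriv
    rw [h4, id]
    ring
  have hpos : ∀ t : ℝ, 0 < t → 0 < deriv η t := by
    intro t ht
    rcases lt_or_ge t (1 / 2) with h | h
    · rw [(hηF t h).deriv_eq]
      exact hFd' t ht (by linarith)
    rw [hηd]
    have h1 : 0 ≤ deriv χ t * (t - F t) :=
      mul_nonneg hχm.deriv_nonneg (by linarith [hFle t])
    have h2 : 0 ≤ (1 - χ t) * deriv F t :=
      mul_nonneg (sub_nonneg.2 (Real.smoothTransition.le_one _)) (hFd t)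
    rcases h.eq_or_lt with rfl | h
    · rw [hχ0 _ le_rfl] at *
      linarith [hFd' (1 / 2) ht (by norm_num)]
    · have : 0 < χ t := Real.smoothTransition.pos_of_pos (by linarith)
      linarith
  have hmono : StrictMonoOn η (Ici 0) :=
    strictMonoOn_of_deriv_pos (convex_Ici 0) hη.continuous.continuousOn fun t ht ↦
      hpos t (by rwa [interior_Ici] at ht)
  refine ⟨η, hη.continuous.continuousOn, hmono, hη0, ?_, hη.contDiffOn, hpos, hη1, ?_⟩
  · apply Subset.antisymm
    · rintro _ ⟨t, ht, rfl⟩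
      have := hmono.monotoneOn self_mem_Ici ht ht
      rwa [hη0] at this
    · intro y hy
      have hy' : (0 : ℝ) ≤ max y 1 := le_max_of_le_right zero_le_one
      have h := intermediate_value_Icc hy' hη.continuous.continuousOn
      rw [hη0, hη1 _ (le_max_right _ _)] at h
      obtain ⟨t, ht, rfl⟩ := h ⟨hy, le_max_left _ _⟩
      exact ⟨t, ht.1, rfl⟩
  · intro ε hε
    obtain ⟨n₁, hn₁⟩ := exists_pow_lt_of_lt_one hε (by norm_num : (1 / 2 : ℝ) < 1)
    refine ⟨max n₁ 2, fun n hn t ht ℓ hℓ ↦ ?_⟩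
    have htn : t ≤ (1 / 2 : ℝ) ^ n := by simpa using ht.2
    have hpow : ∀ m ≤ n, (1 / 2 : ℝ) ^ n ≤ (1 / 2) ^ m := fun m hm ↦
      pow_le_pow_of_le_one (by norm_num) (by norm_num) hm
    have ht2 : t < 1 / 2 := by
      have := hpow 2 ((le_max_right _ _).trans hn)
      norm_num at this htn ⊢
      linarith
    rw [(hηF t ht2).iteratedDeriv_eq]
    have h := hFdecay n t htn ℓ hℓ
    have hD := abs_nonneg (iteratedDeriv ℓ F t)
    have h2 : (0 : ℝ) < 2 ^ n := by positivity
    have hND : N n * |iteratedDeriv ℓ F t| ≤ (1 / 2) ^ n := by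
      rw [one_div, inv_pow, ← one_div, le_div_iff₀ h2]
      nlinarith [mul_nonneg h2.le hD]
    exact hND.trans_lt ((hpow n₁ ((le_max_left _ _).trans hn)).trans_lt hn₁)
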